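/- Fix integers d_l ≥ 2, d_r ≥ 2, L ≥ 1, 1 ≤ w ≤ 2L, and ε ∈ [0,1]. If x ∈ [0,1]^{{−L,…,L}} is a fixed point of the coupled DEC density evolution map, i.e., x_i = f_ε(A_i(x)^{d_l}) · A_i(x)^{d_l−1} for all i ∈ [−L,L], where A_i(x) = 1 − (1/w)·Σ_{j=0}^{w−1} (1 − (1/w)·Σ_{k=0}^{w−1} x_{i+j−k})^{d_r−1} (x_i = 0 for |i| > L) and f_ε(y) = 4ε²/(2 − y(1−ε))², then x_i ≤ ε · A_i(x)^{d_l−1} ≤ ε for every i ∈ [−L,L]; in particular x is also a sub-fixed-point of the coupled BEC density evolution with parameter ε. -/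

import Mathlib

/-- The DEC extrinsic transfer function `f_ε(y) = 4ε²/(2 − y(1−ε))²`. -/
noncomputable def decF (ε y : ℝ) : ℝ := 4 * ε ^ 2 / (2 - y * (1 - ε)) ^ 2

/-- `A_i(x) = 1 − (1/w)·Σ_{j<w} (1 − (1/w)·Σ_{k<w} x_{i+j−k})^{d_r−1}`. -/
noncomputable def coupledA (dr w : ℕ) (x : ℤ → ℝ) (i : ℤ) : ℝ :=
  1 - (1 / (w : ℝ)) * ∑ j ∈ Finset.range w,
    (1 - (1 / (w : ℝ)) * ∑ k ∈ Finset.range w, x (i + (j : ℤ) - (k : ℤ))) ^ (dr - 1)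

theorem average_mem_Icc {w : ℕ} (hw : 1 ≤ w) {f : ℕ → ℝ}
    (hf : ∀ k, f k ∈ Set.Icc (0 : ℝ) 1) :
    (1 / (w : ℝ)) * ∑ k ∈ Finset.range w, f k ∈ Set.Icc (0 : ℝ) 1 := by
  have hw0 : (0 : ℝ) < w := by exact_mod_cast hw
  have h0 : 0 ≤ ∑ k ∈ Finset.range w, f k := Finset.sum_nonneg fun k _ => (hf k).1
  have h1 : ∑ k ∈ Finset.range w, f k ≤ w := by
    simpa using Finset.sum_le_sum fun k (_ : k ∈ Finset.range w) => (hf k).2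
  refine ⟨by positivity, ?_⟩
  rw [one_div_mul_eq_div]
  exact (div_le_one hw0).2 h1

theorem coupledA_mem_Icc (dr : ℕ) {w : ℕ} (hw : 1 ≤ w) {x : ℤ → ℝ}
    (hx : ∀ i, x i ∈ Set.Icc (0 : ℝ) 1) (i : ℤ) :
    coupledA dr w x i ∈ Set.Icc (0 : ℝ) 1 := by
  have h := average_mem_Icc hw (f := fun j =>
    (1 - (1 / (w : ℝ)) * ∑ k ∈ Finset.range w, x (i + (j : ℤ) - (k : ℤ))) ^ (dr - 1))
    fun j => by
      obtain ⟨h0, h1⟩ := average_mem_Icc hw fun k => hx (i + (j : ℤ) - (k : ℤ))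
      exact ⟨pow_nonneg (by linarith) _, pow_le_one₀ (by linarith) (by linarith)⟩
  exact ⟨sub_nonneg.2 h.2, sub_le_self _ h.1⟩

theorem decF_le {ε y : ℝ} (hε : ε ∈ Set.Icc (0 : ℝ) 1) (hy : y ≤ 1) : decF ε y ≤ ε := by
  obtain ⟨h0, h1⟩ := hε
  have hd : 1 + ε ≤ 2 - y * (1 - ε) := by nlinarith
  have hsq : (1 + ε) ^ 2 ≤ (2 - y * (1 - ε)) ^ 2 := by gcongr
  have hpos : 0 < (2 - y * (1 - ε)) ^ 2 := by
    have : 0 < 2 - y * (1 - ε) := by linarith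
    positivity
  rw [decF, div_le_iff₀ hpos]
  have h4 : 4 * ε ≤ (2 - y * (1 - ε)) ^ 2 := by nlinarith [sq_nonneg (1 - ε)]
  nlinarith [mul_le_mul_of_nonneg_left h4 h0]

/-- A fixed point of the coupled DEC density evolution is a sub-fixed-point
of the coupled BEC density evolution with parameter `ε`:
`x_i ≤ ε · A_i(x)^{d_l−1} ≤ ε` for every section `i ∈ [−L,L]`. -/
theorem coupled_DEC_FP_sub_BEC_FP (dl dr L w : ℕ)
    (hdl : 2 ≤ dl) (hdr : 2 ≤ dr) (hL : 1 ≤ L) (hw1 : 1 ≤ w) (hw2 : w ≤ 2 * L)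
    (ε : ℝ) (hε : ε ∈ Set.Icc (0:ℝ) 1)
    (x : ℤ → ℝ) (hx : ∀ i, x i ∈ Set.Icc (0:ℝ) 1)
    (hx0 : ∀ i, (L : ℤ) < |i| → x i = 0)
    (hfp : ∀ i : ℤ, |i| ≤ (L : ℤ) →
      x i = decF ε ((coupledA dr w x i) ^ dl) * (coupledA dr w x i) ^ (dl - 1)) :
    ∀ i : ℤ, |i| ≤ (L : ℤ) →
      x i ≤ ε * (coupledA dr w x i) ^ (dl - 1) ∧
      ε * (coupledA dr w x i) ^ (dl - 1) ≤ ε := by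
  intro i hi
  obtain ⟨h0, h1⟩ := coupledA_mem_Icc dr hw1 hx i
  constructor
  · calc x i = decF ε ((coupledA dr w x i) ^ dl) * (coupledA dr w x i) ^ (dl - 1) := hfp i hi
      _ ≤ ε * (coupledA dr w x i) ^ (dl - 1) :=
        mul_le_mul_of_nonneg_right (decF_le hε (pow_le_one₀ h0 h1)) (pow_nonneg h0 _)
  · exact mul_le_of_le_one_right hε.1 (pow_le_one₀ h0 h1)
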